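/- For every q ∈ (0,1): ∑_{m,n ≥ 0} q^{(1/2)m² − (1/2)mn + (1/2)n² − (1/2)m} / ((q)_m (q)_n) = 2 (−q; q)_∞ · ∑_{n ≥ 0} q^{(3/2)n² − (1/2)n} / ((q)_n (q; q²)_n) + (−q^{1/2}; q)_∞ · ∑_{n ≥ 0} q^{(3/2)n² + n} (−q^{1/2}; q)_{n+1} / (q)_{2n+1}. -/

import Mathlib

open Real

/-- The `q`-Pochhammer symbol `(a;q)_n = ∏_{k=1}^n (1 - a q^{k-1})`. -/
noncomputable def genPoch (a q : ℝ) (n : ℕ) : ℝ := ∏ k ∈ Finset.range n, (1 - a * q ^ k)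

/-- The infinite `q`-Pochhammer symbol `(a;q)_∞ = ∏_{k=1}^∞ (1 - a q^{k-1})`. -/
noncomputable def genPochInf (a q : ℝ) : ℝ := ∏' k : ℕ, (1 - a * q ^ k)


noncomputable def eulerTerm (q z : ℝ) (m : ℕ) : ℝ :=
  q ^ (m * (m - 1) / 2) * z ^ m / genPoch q q m

lemma genPoch_succ (a q : ℝ) (n : ℕ) :
    genPoch a q (n + 1) = genPoch a q n * (1 - a * q ^ n) := Finset.prod_range_succ _ _

lemma genPoch_zero (a q : ℝ) : genPoch a q 0 = 1 := Finset.prod_range_zero _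

lemma genPoch_succ' (a q : ℝ) (n : ℕ) :
    genPoch a q (n + 1) = genPoch (a * q) q n * (1 - a) := by
  unfold genPoch
  rw [Finset.prod_range_succ']
  simp [pow_succ', mul_assoc]

lemma one_sub_pow_pos {q : ℝ} (h0 : 0 < q) (h1 : q < 1) (n : ℕ) : 0 < 1 - q * q ^ n := by
  have : q * q ^ n = q ^ (n + 1) := by ring
  rw [this]
  have := pow_lt_one₀ h0.le h1 (Nat.succ_ne_zero n)
  simp only [Nat.succ_eq_add_one] at this
  linarith

lemma genPoch_pos {q : ℝ} (h0 : 0 < q) (h1 : q < 1) (n : ℕ) : 0 < genPoch q q n :=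
  Finset.prod_pos fun k _ => one_sub_pow_pos h0 h1 k

lemma genPoch_sq_pos {q : ℝ} (h0 : 0 < q) (h1 : q < 1) (n : ℕ) : 0 < genPoch q (q ^ 2) n :=
  Finset.prod_pos fun k _ => by
    rw [← pow_mul]; exact one_sub_pow_pos h0 h1 _

lemma genPoch_neg_pos {q z : ℝ} (h0 : 0 < q) (hz : 0 < z) (n : ℕ) : 0 < genPoch (-z) q n :=
  Finset.prod_pos fun k _ => by
    have : 0 < z * q ^ k := by positivity
    linarith

lemma tri_succ (m : ℕ) : (m + 1) * (m + 1 - 1) / 2 = m * (m - 1) / 2 + m := by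
  rw [Nat.add_sub_cancel, ← Nat.choose_two_right, mul_comm]
  have := Nat.choose_two_right (m + 1)
  rw [Nat.add_sub_cancel, mul_comm] at this
  rw [← this, Nat.choose_succ_succ' m 1, Nat.choose_one_right, add_comm]

lemma tri_cast (m : ℕ) : ((m * (m - 1) / 2 : ℕ) : ℝ) = (m : ℝ) ^ 2 / 2 - m / 2 := by
  induction m with
  | zero => simp
  | succ k ih => rw [tri_succ]; push_cast at ih ⊢; rw [ih]; ring

lemma eulerTerm_succ {q : ℝ} (h0 : 0 < q) (h1 : q < 1) (z : ℝ) (m : ℕ) :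
    eulerTerm q z (m + 1) = eulerTerm q z m * (z * q ^ m / (1 - q * q ^ m)) := by
  unfold eulerTerm
  rw [tri_succ, genPoch_succ]
  have := (genPoch_pos h0 h1 m).ne'
  have := (one_sub_pow_pos h0 h1 m).ne'
  field_simp
  ring

lemma eulerTerm_pos {q z : ℝ} (h0 : 0 < q) (h1 : q < 1) (hz : 0 < z) (m : ℕ) :
    0 < eulerTerm q z m := by
  have := genPoch_pos h0 h1 m
  unfold eulerTerm
  positivity

lemma tendsto_qpow {q : ℝ} (h0 : 0 < q) (h1 : q < 1) :
    Filter.Tendsto (fun n : ℕ => q ^ n) Filter.atTop (nhds 0) :=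
  tendsto_pow_atTop_nhds_zero_of_lt_one h0.le h1

/-- Ratio test in multiplicative form. -/
lemma summable_of_ratio {f g : ℕ → ℝ} (hf : ∀ n, 0 < f n) (hg : ∀ n, f (n + 1) = f n * g n)
    (hl : Filter.Tendsto g Filter.atTop (nhds 0)) : Summable f := by
  refine summable_of_ratio_test_tendsto_lt_one (l := 0) one_pos
    (Filter.Eventually.of_forall fun n => (hf n).ne') ?_
  have : (fun n => ‖f (n + 1)‖ / ‖f n‖) = fun n => ‖g n‖ := by
    funext n
    rw [hg, norm_mul, mul_div_cancel_left₀ _ (norm_ne_zero_iff.mpr (hf n).ne')]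
  rw [this]
  simpa using hl.norm

lemma eulerTerm_summable {q z : ℝ} (h0 : 0 < q) (h1 : q < 1) (hz : 0 < z) :
    Summable (eulerTerm q z) := by
  refine summable_of_ratio (eulerTerm_pos h0 h1 hz) (eulerTerm_succ h0 h1 z) ?_
  have hq := tendsto_qpow h0 h1
  have := (hq.const_mul z).div ((hq.const_mul q).const_sub 1) (by simp)
  exact this.mono_right (le_of_eq (by simp))

lemma euler_step {q z : ℝ} (h0 : 0 < q) (h1 : q < 1) (hz : 0 < z) :
    ∑' m, eulerTerm q z m = (1 + z) * ∑' m, eulerTerm q (z * q) m := by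
  have hs := eulerTerm_summable h0 h1 hz
  have hs' := eulerTerm_summable h0 h1 (mul_pos hz h0)
  have key : ∀ m, eulerTerm q z (m + 1) = eulerTerm q (z * q) (m + 1)
      + z * eulerTerm q (z * q) m := by
    intro m
    unfold eulerTerm
    rw [tri_succ, genPoch_succ]
    have := (genPoch_pos h0 h1 m).ne'
    have := (one_sub_pow_pos h0 h1 m).ne'
    field_simp
    ring
  have e0 : ∀ z, eulerTerm q z 0 = 1 := by intro z; simp [eulerTerm, genPoch_zero]
  rw [hs.tsum_eq_zero_add]
  simp_rw [key]
  rw [((summable_nat_add_iff 1).mpr hs').tsum_add (hs'.mul_left z), tsum_mul_left, e0]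
  have := hs'.tsum_eq_zero_add
  rw [e0] at this
  linarith

lemma euler_iter {q z : ℝ} (h0 : 0 < q) (h1 : q < 1) (hz : 0 < z) (N : ℕ) :
    ∑' m, eulerTerm q z m = genPoch (-z) q N * ∑' m, eulerTerm q (z * q ^ N) m := by
  induction N with
  | zero => simp [genPoch_zero]
  | succ k ih =>
    rw [ih, euler_step h0 h1 (by positivity : 0 < z * q ^ k), genPoch_succ]
    rw [pow_succ, mul_assoc z]
    ring

lemma euler {q z : ℝ} (h0 : 0 < q) (h1 : q < 1) (hz : 0 < z) :
    ∑' m, eulerTerm q z m = genPochInf (-z) q := by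
  have hq := tendsto_qpow h0 h1
  have hmul : Multipliable (fun k : ℕ => 1 - (-z) * q ^ k) := by
    have := multipliable_one_add_of_summable (f := fun k : ℕ => z * q ^ k)
      (by simpa using (summable_geometric_of_lt_one h0.le h1).mul_left z |>.norm)
    refine this.congr ?_
    intro k; ring
  have hP : Filter.Tendsto (fun N => genPoch (-z) q N) Filter.atTop
      (nhds (genPochInf (-z) q)) := hmul.hasProd.tendsto_prod_nat
  have hE : Filter.Tendsto (fun N => ∑' m, eulerTerm q (z * q ^ N) m) Filter.atTop
      (nhds (∑' m, eulerTerm q 0 m)) := by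
    refine tendsto_tsum_of_dominated_convergence (eulerTerm_summable h0 h1 hz) ?_ ?_
    · intro m
      have hz0 : Filter.Tendsto (fun N : ℕ => z * q ^ N) Filter.atTop (nhds 0) := by
        simpa using hq.const_mul z
      unfold eulerTerm
      exact ((hz0.pow m).const_mul _).div_const _
    · refine Filter.Eventually.of_forall fun N m => ?_
      have hzN : 0 < z * q ^ N := by positivity
      rw [Real.norm_of_nonneg (eulerTerm_pos h0 h1 hzN m).le]
      have := genPoch_pos h0 h1 m
      unfold eulerTerm
      have : z * q ^ N ≤ z := mul_le_of_le_one_right hz.le (pow_le_one₀ h0.le h1.le)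
      gcongr
  have hE1 : ∑' m, eulerTerm q 0 m = 1 := by
    rw [tsum_eq_single 0]
    · simp [eulerTerm, genPoch_zero]
    · intro m hm
      simp [eulerTerm, hm]
  rw [hE1] at hE
  have h := hP.mul hE
  rw [mul_one] at h
  refine tendsto_nhds_unique ?_ h
  simp_rw [← euler_iter h0 h1 hz]
  exact tendsto_const_nhds

lemma even_poch {q : ℝ} (h0 : 0 < q) (k : ℕ) :
    genPoch (-(q ^ (-(k : ℝ)))) q (k + 1) * q ^ ((k : ℝ) * (k + 1) / 2) =
      2 * genPoch (-q) q k := by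
  induction k with
  | zero => simp [genPoch]; norm_num
  | succ k ih =>
    rw [genPoch_succ', genPoch_succ (-q)]
    have e1 : -(q ^ (-((k + 1 : ℕ) : ℝ))) * q = -(q ^ (-(k : ℝ))) := by
      rw [neg_mul, ← Real.rpow_add_one h0.ne']; push_cast; ring_nf
    have e2 : q ^ (((k + 1 : ℕ) : ℝ) * (((k + 1 : ℕ) : ℝ) + 1) / 2) =
        q ^ ((k : ℝ) * (k + 1) / 2) * q ^ ((k : ℝ) + 1) := by
      rw [← Real.rpow_add h0]; push_cast; ring_nf
    have e3 : q ^ (-((k + 1 : ℕ) : ℝ)) * q ^ ((k : ℝ) + 1) = 1 := by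
      rw [← Real.rpow_add h0]; push_cast; simp
    have e4 : q ^ ((k : ℝ) + 1) = q * q ^ k := by
      rw [Real.rpow_add_one h0.ne', Real.rpow_natCast]; ring
    rw [e1, e2, ← mul_assoc, ← mul_assoc 2, ← ih]
    rw [show (1 - -q * q ^ k) = 1 + q * q ^ k by ring, ← e4]
    linear_combination (genPoch (-(q ^ (-(k : ℝ)))) q (k + 1) * q ^ ((k : ℝ) * (k + 1) / 2)) * e3

lemma odd_poch {q : ℝ} (h0 : 0 < q) (k : ℕ) :
    genPoch (-(q ^ (-(k : ℝ) - 1 / 2))) q (k + 1) * q ^ (((k : ℝ) + 1) ^ 2 / 2) =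
      genPoch (-(q ^ ((1 : ℝ) / 2))) q (k + 1) := by
  induction k with
  | zero =>
    simp only [genPoch, zero_add, Finset.prod_range_one, pow_zero, mul_one]
    have : q ^ (-((0 : ℕ) : ℝ) - 1 / 2) * q ^ ((((0 : ℕ) : ℝ) + 1) ^ 2 / 2) = 1 := by
      rw [← Real.rpow_add h0]; norm_num
    have e : q ^ ((((0 : ℕ) : ℝ) + 1) ^ 2 / 2) = q ^ ((1 : ℝ) / 2) := by norm_num
    rw [e] at this ⊢
    linear_combination this
  | succ k ih =>
    rw [genPoch_succ', genPoch_succ (-(q ^ ((1 : ℝ) / 2)))]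
    have e1 : -(q ^ (-((k + 1 : ℕ) : ℝ) - 1 / 2)) * q = -(q ^ (-(k : ℝ) - 1 / 2)) := by
      rw [neg_mul, ← Real.rpow_add_one h0.ne']; push_cast; ring_nf
    have e2 : q ^ ((((k + 1 : ℕ) : ℝ) + 1) ^ 2 / 2) =
        q ^ (((k : ℝ) + 1) ^ 2 / 2) * q ^ ((k : ℝ) + 3 / 2) := by
      rw [← Real.rpow_add h0]; push_cast; ring_nf
    have e3 : q ^ (-((k + 1 : ℕ) : ℝ) - 1 / 2) * q ^ ((k : ℝ) + 3 / 2) = 1 := by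
      rw [← Real.rpow_add h0]; push_cast; ring_nf; simp
    have e4 : q ^ ((k : ℝ) + 3 / 2) = q ^ ((1 : ℝ) / 2) * q ^ (k + 1) := by
      rw [← Real.rpow_natCast, ← Real.rpow_add h0]; push_cast; ring_nf
    rw [e1, e2, ← ih]
    rw [neg_mul, ← e4]
    linear_combination (genPoch (-(q ^ (-(k : ℝ) - 1 / 2))) q (k + 1)
      * q ^ (((k : ℝ) + 1) ^ 2 / 2)) * e3

lemma genPoch_double (q : ℝ) (k : ℕ) :
    genPoch q q (2 * k) = genPoch q (q ^ 2) k * genPoch q q k * genPoch (-q) q k := by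
  induction k with
  | zero => simp [genPoch]
  | succ k ih =>
    rw [show 2 * (k + 1) = 2 * k + 1 + 1 by ring]
    simp only [genPoch_succ]
    rw [ih]
    ring

lemma even_term {q : ℝ} (h0 : 0 < q) (h1 : q < 1) (k : ℕ) :
    q ^ (((2 * k : ℕ) : ℝ) ^ 2 / 2) / genPoch q q (2 * k)
        * ∑' m, eulerTerm q (q ^ (-((2 * k : ℕ) : ℝ) / 2)) m =
      2 * genPochInf (-q) q * (q ^ ((3 / 2) * ((k : ℝ)) ^ 2 - (k : ℝ) / 2) /
            (genPoch q q k * genPoch q (q ^ 2) k)) := by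
  rw [euler_iter h0 h1 (Real.rpow_pos_of_pos h0 _) (k + 1)]
  have e0 : q ^ (-((2 * k : ℕ) : ℝ) / 2) = q ^ (-(k : ℝ)) := by push_cast; ring_nf
  have e1 : q ^ (-(k : ℝ)) * q ^ (k + 1) = q := by
    rw [← Real.rpow_natCast, ← Real.rpow_add h0]; push_cast; simp
  have e2 : q ^ (((2 * k : ℕ) : ℝ) ^ 2 / 2) =
      q ^ ((3 / 2) * ((k : ℝ)) ^ 2 - (k : ℝ) / 2) * q ^ ((k : ℝ) * (k + 1) / 2) := by
    rw [← Real.rpow_add h0]; push_cast; ring_nf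
  rw [e0, e1, e2, euler h0 h1 h0, genPoch_double]
  have h := even_poch h0 k
  have := (genPoch_pos h0 h1 k).ne'
  have := (genPoch_sq_pos h0 h1 k).ne'
  have := (genPoch_neg_pos h0 h0 k).ne'
  rw [div_mul_eq_mul_div, mul_div_assoc', div_eq_div_iff (by positivity) (by positivity)]
  linear_combination (q ^ ((3 / 2) * ((k : ℝ)) ^ 2 - (k : ℝ) / 2) * genPochInf (-q) q *
    genPoch q q k * genPoch q (q ^ 2) k) * h

lemma odd_term {q : ℝ} (h0 : 0 < q) (h1 : q < 1) (k : ℕ) :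
    q ^ (((2 * k + 1 : ℕ) : ℝ) ^ 2 / 2) / genPoch q q (2 * k + 1)
        * ∑' m, eulerTerm q (q ^ (-((2 * k + 1 : ℕ) : ℝ) / 2)) m =
      genPochInf (-(q ^ ((1 : ℝ) / 2))) q * (q ^ ((3 / 2) * ((k : ℝ)) ^ 2 + (k : ℝ)) *
              genPoch (-(q ^ ((1 : ℝ) / 2))) q (k + 1) / genPoch q q (2 * k + 1)) := by
  rw [euler_iter h0 h1 (Real.rpow_pos_of_pos h0 _) (k + 1)]
  have e0 : q ^ (-((2 * k + 1 : ℕ) : ℝ) / 2) = q ^ (-(k : ℝ) - 1 / 2) := by push_cast; ring_nf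
  have e1 : q ^ (-(k : ℝ) - 1 / 2) * q ^ (k + 1) = q ^ ((1 : ℝ) / 2) := by
    rw [← Real.rpow_natCast, ← Real.rpow_add h0]; push_cast; ring_nf
  have e2 : q ^ (((2 * k + 1 : ℕ) : ℝ) ^ 2 / 2) =
      q ^ ((3 / 2) * ((k : ℝ)) ^ 2 + (k : ℝ)) * q ^ (((k : ℝ) + 1) ^ 2 / 2) := by
    rw [← Real.rpow_add h0]; push_cast; ring_nf
  rw [e0, e1, e2, euler h0 h1 (Real.rpow_pos_of_pos h0 _), ← odd_poch h0 k]
  ring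

lemma even_summable {q : ℝ} (h0 : 0 < q) (h1 : q < 1) :
    Summable fun k : ℕ => q ^ ((3 / 2) * ((k : ℝ)) ^ 2 - (k : ℝ) / 2) /
            (genPoch q q k * genPoch q (q ^ 2) k) := by
  have hq := tendsto_qpow h0 h1
  refine summable_of_ratio (g := fun k => q * (q ^ k) ^ 3 /
    ((1 - q * q ^ k) * (1 - q * (q ^ k) ^ 2))) ?_ ?_ ?_
  · intro k
    have := genPoch_pos h0 h1 k
    have := genPoch_sq_pos h0 h1 k
    positivity
  · intro k
    have e : q ^ ((3 / 2) * (((k + 1 : ℕ) : ℝ)) ^ 2 - ((k + 1 : ℕ) : ℝ) / 2) =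
        q ^ ((3 / 2) * ((k : ℝ)) ^ 2 - (k : ℝ) / 2) * (q * (q ^ k) ^ 3) := by
      rw [show q * (q ^ k) ^ 3 = q ^ (3 * k + 1) by ring, ← Real.rpow_natCast q (3 * k + 1),
        ← Real.rpow_add h0]
      push_cast; ring_nf
    rw [e, genPoch_succ, genPoch_succ, div_mul_div_comm, pow_right_comm]
    congr 1
    ring
  · have := ((hq.pow 3).const_mul q).div
      (((hq.const_mul q).const_sub 1).mul (((hq.pow 2).const_mul q).const_sub 1)) (by simp)
    exact this.mono_right (le_of_eq (by simp))

lemma odd_summable {q : ℝ} (h0 : 0 < q) (h1 : q < 1) :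
    Summable fun k : ℕ => q ^ ((3 / 2) * ((k : ℝ)) ^ 2 + (k : ℝ)) *
              genPoch (-(q ^ ((1 : ℝ) / 2))) q (k + 1) / genPoch q q (2 * k + 1) := by
  have hq := tendsto_qpow h0 h1
  refine summable_of_ratio (g := fun k => q ^ ((5 : ℝ) / 2) * (q ^ k) ^ 3 *
    (1 + q ^ ((1 : ℝ) / 2) * q * q ^ k) /
    ((1 - q ^ 2 * (q ^ k) ^ 2) * (1 - q ^ 3 * (q ^ k) ^ 2))) ?_ ?_ ?_
  · intro k
    have := genPoch_pos h0 h1 (2 * k + 1)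
    have := genPoch_neg_pos h0 (Real.rpow_pos_of_pos h0 (1 / 2)) (k + 1)
    positivity
  · intro k
    have e : q ^ ((3 / 2) * (((k + 1 : ℕ) : ℝ)) ^ 2 + ((k + 1 : ℕ) : ℝ)) =
        q ^ ((3 / 2) * ((k : ℝ)) ^ 2 + (k : ℝ)) * (q ^ ((5 : ℝ) / 2) * (q ^ k) ^ 3) := by
      rw [show (q ^ k) ^ 3 = q ^ (3 * k) by ring, ← Real.rpow_natCast q (3 * k),
        ← Real.rpow_add h0, ← Real.rpow_add h0]
      push_cast; ring_nf
    rw [e, show 2 * (k + 1) + 1 = 2 * k + 1 + 1 + 1 by ring, genPoch_succ _ _ (k + 1),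
      genPoch_succ _ _ (2 * k + 1 + 1), genPoch_succ _ _ (2 * k + 1), div_mul_div_comm]
    congr 1 <;> ring
  · have := (((hq.pow 3).const_mul (q ^ ((5 : ℝ) / 2))).mul
      ((hq.const_mul (q ^ ((1 : ℝ) / 2) * q)).const_add 1)).div
      ((((hq.pow 2).const_mul (q ^ 2)).const_sub 1).mul
        (((hq.pow 2).const_mul (q ^ 3)).const_sub 1)) (by simp)
    exact this.mono_right (le_of_eq (by simp))

/-- For every `q ∈ (0,1)`:
`∑_{m,n ≥ 0} q^{½m² - ½mn + ½n² - ½m}/((q)_m (q)_n)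
  = 2 (-q;q)_∞ ∑_{n ≥ 0} q^{(3/2)n² - ½n}/((q)_n (q;q²)_n)
    + (-q^{1/2};q)_∞ ∑_{n ≥ 0} q^{(3/2)n² + n} (-q^{1/2};q)_{n+1}/(q)_{2n+1}`. -/
theorem nahmSum_rank_two_split' (q : ℝ) (hq : q ∈ Set.Ioo (0 : ℝ) 1) :
    (∑' p : ℕ × ℕ,
        q ^ (((p.1 : ℝ)) ^ 2 / 2 - (p.1 : ℝ) * (p.2 : ℝ) / 2 + ((p.2 : ℝ)) ^ 2 / 2 -
              (p.1 : ℝ) / 2) /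
          (genPoch q q p.1 * genPoch q q p.2)) =
      2 * genPochInf (-q) q *
          (∑' n : ℕ, q ^ ((3 / 2) * ((n : ℝ)) ^ 2 - (n : ℝ) / 2) /
            (genPoch q q n * genPoch q (q ^ 2) n)) +
        genPochInf (-(q ^ ((1 : ℝ) / 2))) q *
          (∑' n : ℕ, q ^ ((3 / 2) * ((n : ℝ)) ^ 2 + (n : ℝ)) *
              genPoch (-(q ^ ((1 : ℝ) / 2))) q (n + 1) / genPoch q q (2 * n + 1)) := by
  obtain ⟨h0, h1⟩ := hq
  set f : ℕ × ℕ → ℝ := fun p => q ^ (((p.1 : ℝ)) ^ 2 / 2 - (p.1 : ℝ) * (p.2 : ℝ) / 2 +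
      ((p.2 : ℝ)) ^ 2 / 2 - (p.1 : ℝ) / 2) / (genPoch q q p.1 * genPoch q q p.2) with hf
  have hterm : ∀ n m : ℕ, f (m, n) = q ^ ((n : ℝ) ^ 2 / 2) / genPoch q q n *
      eulerTerm q (q ^ (-(n : ℝ) / 2)) m := by
    intro n m
    simp only [hf, eulerTerm]
    rw [← Real.rpow_natCast q (m * (m - 1) / 2), tri_cast,
      ← Real.rpow_natCast (q ^ (-(n : ℝ) / 2)) m, ← Real.rpow_mul h0.le, ← Real.rpow_add h0,
      div_mul_div_comm, ← Real.rpow_add h0, mul_comm (genPoch q q m)]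
    congr 2
    ring
  have hrow : ∀ n : ℕ, HasSum (fun m => f (m, n)) (q ^ ((n : ℝ) ^ 2 / 2) / genPoch q q n *
      ∑' m, eulerTerm q (q ^ (-(n : ℝ) / 2)) m) := by
    intro n
    simp_rw [hterm]
    exact (eulerTerm_summable h0 h1 (Real.rpow_pos_of_pos h0 _)).hasSum.mul_left _
  have hE := (even_summable h0 h1).hasSum.mul_left (2 * genPochInf (-q) q)
  have hO := (odd_summable h0 h1).hasSum.mul_left (genPochInf (-(q ^ ((1 : ℝ) / 2))) q)
  simp_rw [← even_term h0 h1] at hE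
  simp_rw [← odd_term h0 h1] at hO
  have hsum := HasSum.even_add_odd (f := fun n : ℕ => q ^ ((n : ℝ) ^ 2 / 2) / genPoch q q n *
      ∑' m, eulerTerm q (q ^ (-(n : ℝ) / 2)) m) hE hO
  have hnn : ∀ p, 0 ≤ f p := by
    intro p
    have := genPoch_pos h0 h1 p.1
    have := genPoch_pos h0 h1 p.2
    simp only [hf]
    positivity
  have hS : Summable (fun p : ℕ × ℕ => f p.swap) := by
    rw [summable_prod_of_nonneg (fun p => hnn _)]
    refine ⟨fun n => (hrow n).summable, ?_⟩
    refine hsum.summable.congr ?_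
    intro n
    first
      | exact (hrow n).tsum_eq
      | exact (hrow n).tsum_eq.symm
  have h2 := hS.hasSum.prod_fiberwise (fun n => hrow n)
  rw [← (Equiv.prodComm ℕ ℕ).tsum_eq f]
  exact h2.unique hsum
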